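/- Let D be an N×N matrix with nonnegative real entries, decomposed as D = D^1 + D^2 + ... + D^K where each D^k is an N×N matrix with nonnegative entries. Let r^1, ..., r^K be positive reals with R = r^1 + ... + r^K, and let δ ≥ 0. If D is not the zero matrix, then max over k of T_LB(D^k; r^k, δ) ≥ δ + ρ(D)/R. (This is the global lower bound of Lemma 1: the completion time of any assignment of the coflow's demand across the K cores is at least δ + ρ(D)/R.) -/

import Mathlib

open Finset

/-- Maximum port load of a demand matrix: the maximum of all row sums and column sums. -/
noncomputable def rho {N : ℕ} (D : Matrix (Fin N) (Fin N) ℝ) : ℝ :=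
  max (⨆ i, ∑ j, D i j) (⨆ j, ∑ i, D i j)

/-- Per-core lower bound `T_LB(D; r, δ)`: the maximum over rows and columns of
`load / r + (nonzero count) * δ`. -/
noncomputable def TLB {N : ℕ} (D : Matrix (Fin N) (Fin N) ℝ) (r δ : ℝ) : ℝ :=
  max (⨆ i, (∑ j, D i j) / r + ((univ.filter fun j => 0 < D i j).card : ℝ) * δ)
      (⨆ j, (∑ i, D i j) / r + ((univ.filter fun i => 0 < D i j).card : ℝ) * δ)

/-- Maximum number of strictly positive entries in any row or column. -/
noncomputable def tau {N : ℕ} (D : Matrix (Fin N) (Fin N) ℝ) : ℕ :=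
  max (univ.sup fun i => (univ.filter fun j => 0 < D i j).card)
      (univ.sup fun j => (univ.filter fun i => 0 < D i j).card)

/-- One port: some core serves at least its proportional share of the load. -/
lemma port_bound {N K : ℕ} (v : Fin N → ℝ) (w : Fin K → Fin N → ℝ)
    (hw : ∀ k j, 0 ≤ w k j) (hv : ∀ j, v j = ∑ k, w k j)
    (r : Fin K → ℝ) (hr : ∀ k, 0 < r k) (δ : ℝ) (hδ : 0 ≤ δ) (hpos : 0 < ∑ j, v j) :
    ∃ k, δ + (∑ j, v j) / (∑ k, r k) ≤
      (∑ j, w k j) / r k + ((univ.filter fun j => 0 < w k j).card : ℝ) * δ := by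
  have htot : ∑ j, v j = ∑ k, ∑ j, w k j := by
    rw [sum_comm]; exact sum_congr rfl fun j _ => hv j
  have hK : (univ : Finset (Fin K)).Nonempty := by
    by_contra h
    rw [not_nonempty_iff_eq_empty] at h
    rw [htot, h] at hpos
    simp at hpos
  have hR : 0 < ∑ k, r k := sum_pos (fun k _ => hr k) hK
  obtain ⟨k, -, hk⟩ : ∃ k ∈ (univ : Finset (Fin K)),
      r k * ((∑ j, v j) / (∑ k, r k)) ≤ ∑ j, w k j := by
    apply exists_le_of_sum_le hK
    rw [← sum_mul, mul_div_cancel₀ _ hR.ne', htot]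
  have hq : 0 < (∑ j, v j) / (∑ k, r k) := div_pos hpos hR
  have hwk : 0 < ∑ j, w k j := lt_of_lt_of_le (mul_pos (hr k) hq) hk
  obtain ⟨j, -, hj⟩ := (sum_pos_iff_of_nonneg (fun j _ => hw k j)).1 hwk
  have hc : 1 ≤ (univ.filter fun j => 0 < w k j).card :=
    card_pos.2 ⟨j, by simpa using hj⟩
  have hc' : (1 : ℝ) ≤ ((univ.filter fun j => 0 < w k j).card : ℝ) := by exact_mod_cast hc
  refine ⟨k, ?_⟩
  have h1 : (∑ j, v j) / (∑ k, r k) ≤ (∑ j, w k j) / r k := by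
    rw [le_div_iff₀ (hr k), mul_comm]; exact hk
  nlinarith

/-- **Global lower bound (Lemma 1).** For any decomposition `D = Σ_k D^k` of a nonzero
nonnegative demand matrix across `K` cores with positive rates `r^k`, aggregate rate
`R = Σ_k r^k` and reconfiguration delay `δ ≥ 0`, the maximum per-core lower bound is at
least `δ + ρ(D) / R`. -/
theorem global_lower_bound {N K : ℕ} (D : Matrix (Fin N) (Fin N) ℝ)
    (Dk : Fin K → Matrix (Fin N) (Fin N) ℝ)
    (hD : ∀ i j, 0 ≤ D i j) (hDk : ∀ k i j, 0 ≤ Dk k i j)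
    (hsum : D = ∑ k, Dk k)
    (r : Fin K → ℝ) (hr : ∀ k, 0 < r k) (R : ℝ) (hR : R = ∑ k, r k)
    (δ : ℝ) (hδ : 0 ≤ δ) (hD0 : D ≠ 0) :
    δ + rho D / R ≤ ⨆ k, TLB (Dk k) (r k) δ := by
  subst hR
  have hent : ∀ i j, D i j = ∑ k, Dk k i j := by
    intro i j; rw [hsum, Matrix.sum_apply]
  obtain ⟨i₀, j₀, h₀⟩ : ∃ i j, D i j ≠ 0 := by
    by_contra! h
    exact hD0 (by ext i j; simpa using h i j)
  have hrow : 0 < ∑ j, D i₀ j :=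
    sum_pos' (fun j _ => hD i₀ j) ⟨j₀, mem_univ _, lt_of_le_of_ne (hD _ _) h₀.symm⟩
  haveI : Nonempty (Fin N) := ⟨i₀⟩
  have hrho : 0 < rho D :=
    lt_of_lt_of_le hrow (le_max_of_le_left
      (le_ciSup (f := fun i => ∑ j, D i j) (Set.finite_range _).bddAbove i₀))
  have hk : ∀ k, TLB (Dk k) (r k) δ ≤ ⨆ k, TLB (Dk k) (r k) δ := fun k =>
    le_ciSup (f := fun k => TLB (Dk k) (r k) δ) (Set.finite_range _).bddAbove k
  rcases max_choice (⨆ i, ∑ j, D i j) (⨆ j, ∑ i, D i j) with h | h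
  · obtain ⟨i, hi⟩ := exists_eq_ciSup_of_finite (f := fun i => ∑ j, D i j)
    have he : rho D = ∑ j, D i j := h.trans hi.symm
    rw [he] at hrho ⊢
    obtain ⟨k, hb⟩ := port_bound (fun j => D i j) (fun k j => Dk k i j)
      (fun k j => hDk k i j) (fun j => hent i j) r hr δ hδ hrho
    refine hb.trans (le_trans (le_max_of_le_left ?_) (hk k))
    exact le_ciSup (f := fun i => (∑ j, Dk k i j) / r k +
      ((univ.filter fun j => 0 < Dk k i j).card : ℝ) * δ) (Set.finite_range _).bddAbove i
  · obtain ⟨j, hj⟩ := exists_eq_ciSup_of_finite (f := fun j => ∑ i, D i j)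
    have he : rho D = ∑ i, D i j := h.trans hj.symm
    rw [he] at hrho ⊢
    obtain ⟨k, hb⟩ := port_bound (fun i => D i j) (fun k i => Dk k i j)
      (fun k i => hDk k i j) (fun i => hent i j) r hr δ hδ hrho
    refine hb.trans (le_trans (le_max_of_le_right ?_) (hk k))
    exact le_ciSup (f := fun j => (∑ i, Dk k i j) / r k +
      ((univ.filter fun i => 0 < Dk k i j).card : ℝ) * δ) (Set.finite_range _).bddAbove j
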